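/- Every nontrivial real Lie superalgebra L of dimension 3 has trivial Bogomolov multiplier B̃₀(L) = 0. Explicitly, B̃₀ vanishes for L(2,1) = ⟨a, b | α : [a,b]=b, [a,α]=½α, [α,α]=b⟩, for L¹(1,2) = ⟨a | α, β : [α,α]=a, [β,β]=a⟩ and for L²(1,2) = ⟨a | α, β : [α,α]=a, [β,β]=−a⟩. -/

import Mathlib

/-!
Basic definitions for Lie superalgebras over a commutative ring `K`,
graded ideals, the nonabelian (CP) exterior products and the Bogomolov multiplier.
-/

universe u v

namespace BogomolovSuper

/-- The sign `(-1)^{|i||j|}` attached to a pair of `ℤ₂`-degrees. -/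
def sgn (i j : ZMod 2) : ℤ := (-1) ^ (i.val * j.val)

/-- A Lie superalgebra structure on a `K`-module `L`: a `ℤ₂`-grading
`gr` with `L = gr 0 ⊕ gr 1` together with a super bracket satisfying
super skew-symmetry, the super Jacobi identity and `[x,x] = 0` for even `x`. -/
structure SuperAlg (K : Type u) [CommRing K] (L : Type v)
    [AddCommGroup L] [Module K L] where
  bk : L →ₗ[K] L →ₗ[K] L
  gr : ZMod 2 → Submodule K L
  gr_inf : gr 0 ⊓ gr 1 = ⊥
  gr_sup : gr 0 ⊔ gr 1 = ⊤
  bk_gr : ∀ i j : ZMod 2, ∀ x ∈ gr i, ∀ y ∈ gr j, bk x y ∈ gr (i + j)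
  skew : ∀ i j : ZMod 2, ∀ x ∈ gr i, ∀ y ∈ gr j, bk x y = -(sgn i j • bk y x)
  jacobi : ∀ i j : ZMod 2, ∀ x ∈ gr i, ∀ y ∈ gr j, ∀ z : L,
    bk x (bk y z) = bk (bk x y) z + sgn i j • bk y (bk x z)
  even_sq : ∀ x ∈ gr 0, bk x x = 0

variable {K : Type u} [CommRing K]

section Defs

variable {L L' E : Type v} [AddCommGroup L] [Module K L]
  [AddCommGroup L'] [Module K L'] [AddCommGroup E] [Module K E]

/-- A homomorphism of Lie superalgebras of even degree (degree zero). -/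
def IsSuperHom (s : SuperAlg K L) (s' : SuperAlg K L') (f : L →ₗ[K] L') : Prop :=
  (∀ x y : L, f (s.bk x y) = s'.bk (f x) (f y)) ∧
  (∀ i : ZMod 2, ∀ x ∈ s.gr i, f x ∈ s'.gr i)

/-- A graded (homogeneous) ideal of a Lie superalgebra. -/
def IsGradedIdeal (s : SuperAlg K L) (M : Submodule K L) : Prop :=
  (∀ x : L, ∀ m ∈ M, s.bk x m ∈ M ∧ s.bk m x ∈ M) ∧
  (∀ m ∈ M, ∃ m₀ ∈ M ⊓ s.gr 0, ∃ m₁ ∈ M ⊓ s.gr 1, m = m₀ + m₁)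

/-- The sub-Lie-superalgebra generated by a set: the smallest submodule
containing the set and closed under the bracket. -/
def lieSpan (s : SuperAlg K E) (S : Set E) : Submodule K E :=
  sInf {p : Submodule K E | S ⊆ p ∧ ∀ x ∈ p, ∀ y ∈ p, s.bk x y ∈ p}

/-- `K(L)`: the set of all brackets `[a,b]`. -/
def bkSet (s : SuperAlg K L) : Set L := {x : L | ∃ a b : L, x = s.bk a b}

/-- The derived subalgebra `L² = [L,L]` (as a submodule; it is a graded ideal). -/
def derived (s : SuperAlg K L) : Submodule K L := Submodule.span K (bkSet s)

/-- The descending central series of a Lie superalgebra. -/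
def lcs (s : SuperAlg K L) : ℕ → Submodule K L
  | 0 => ⊤
  | n + 1 => Submodule.span K {x : L | ∃ a ∈ lcs s n, ∃ b : L, x = s.bk a b}

/-- Nilpotency of a Lie superalgebra. -/
def IsNilpotentSuper (s : SuperAlg K L) : Prop := ∃ c : ℕ, lcs s c = ⊥

/-- A Lie super exterior pairing on a pair of graded ideals `M`, `N` of `(L, s)`,
with values in a Lie superalgebra `(E, t)`. -/
structure IsExtPairing (s : SuperAlg K L) (M N : Submodule K L)
    (t : SuperAlg K E) (ρ : L → L → E) : Prop where
  grade : ∀ i j : ZMod 2, ∀ m ∈ M ⊓ s.gr i, ∀ n ∈ N ⊓ s.gr j, ρ m n ∈ t.gr (i + j)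
  smul_left : ∀ (c : K) (i j : ZMod 2), ∀ m ∈ M ⊓ s.gr i, ∀ n ∈ N ⊓ s.gr j,
    ρ (c • m) n = c • ρ m n
  smul_right : ∀ (c : K) (i j : ZMod 2), ∀ m ∈ M ⊓ s.gr i, ∀ n ∈ N ⊓ s.gr j,
    ρ m (c • n) = c • ρ m n
  add_left : ∀ (i j : ZMod 2), ∀ m ∈ M ⊓ s.gr i, ∀ m' ∈ M ⊓ s.gr i, ∀ n ∈ N ⊓ s.gr j,
    ρ (m + m') n = ρ m n + ρ m' n
  add_right : ∀ (i j : ZMod 2), ∀ m ∈ M ⊓ s.gr i, ∀ n ∈ N ⊓ s.gr j, ∀ n' ∈ N ⊓ s.gr j,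
    ρ m (n + n') = ρ m n + ρ m n'
  bk_left : ∀ (i i' j : ZMod 2), ∀ m ∈ M ⊓ s.gr i, ∀ m' ∈ M ⊓ s.gr i', ∀ n ∈ N ⊓ s.gr j,
    ρ (s.bk m m') n = ρ m (s.bk m' n) - sgn i i' • ρ m' (s.bk m n)
  bk_right : ∀ (i j j' : ZMod 2), ∀ m ∈ M ⊓ s.gr i, ∀ n ∈ N ⊓ s.gr j, ∀ n' ∈ N ⊓ s.gr j',
    ρ m (s.bk n n') = sgn j' (i + j) • ρ (s.bk n' m) n - sgn i j • ρ (s.bk n m) n'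
  bk_pair : ∀ (i j i' j' : ZMod 2), ∀ m ∈ M ⊓ s.gr i, ∀ n ∈ N ⊓ s.gr j,
    ∀ m' ∈ M ⊓ s.gr i', ∀ n' ∈ N ⊓ s.gr j',
    t.bk (ρ m n) (ρ m' n') = -(sgn i j • ρ (s.bk n m) (s.bk m' n'))

/-- A Lie super `B̃₀`-pairing: an exterior pairing that moreover kills the
commutativity-preserving relations. -/
structure IsB0Pairing (s : SuperAlg K L) (M N : Submodule K L)
    (t : SuperAlg K E) (ρ : L → L → E)
    extends IsExtPairing s M N t ρ : Prop where
  rel_pair : ∀ (i j i' j' : ZMod 2), ∀ m ∈ M ⊓ s.gr i, ∀ n ∈ N ⊓ s.gr j,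
    ∀ m' ∈ M ⊓ s.gr i', ∀ n' ∈ N ⊓ s.gr j',
    s.bk m n + sgn i' j' • s.bk m' n' = 0 → ρ m n + sgn i' j' • ρ m' n' = 0
  rel_even : ∀ m ∈ M ⊓ s.gr 0, ∀ n ∈ N ⊓ s.gr 0, s.bk m n = 0 → ρ m n = 0

/-- The set of wedge generators `m ∧ n` (`m`, `n` homogeneous). -/
def wedgeSet (s : SuperAlg K L) (M N : Submodule K L) (ρ : L → L → E) : Set E :=
  {e : E | ∃ i j : ZMod 2, ∃ m ∈ M ⊓ s.gr i, ∃ n ∈ N ⊓ s.gr j, e = ρ m n}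

/-- `(E, t, ρ)` is the nonabelian exterior product `M ∧ N`: `ρ` is a universal
exterior pairing whose image generates `E`. -/
structure IsExtProduct (s : SuperAlg K L) (M N : Submodule K L)
    (t : SuperAlg K E) (ρ : L → L → E) : Prop where
  pairing : IsExtPairing s M N t ρ
  gen : Submodule.span K (wedgeSet s M N ρ) = ⊤
  lift : ∀ {E' : Type v} [AddCommGroup E'] [Module K E'],
    ∀ (t' : SuperAlg K E') (ρ' : L → L → E'), IsExtPairing s M N t' ρ' →
    ∃ f : E →ₗ[K] E', IsSuperHom t t' f ∧
      ∀ (i j : ZMod 2), ∀ m ∈ M ⊓ s.gr i, ∀ n ∈ N ⊓ s.gr j, f (ρ m n) = ρ' m n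

/-- `(E, t, ρ)` is the commutativity preserving (CP) exterior product `M ⋏ N`:
`ρ` is a universal `B̃₀`-pairing whose image generates `E`. -/
structure IsCPProduct (s : SuperAlg K L) (M N : Submodule K L)
    (t : SuperAlg K E) (ρ : L → L → E) : Prop where
  pairing : IsB0Pairing s M N t ρ
  gen : Submodule.span K (wedgeSet s M N ρ) = ⊤
  lift : ∀ {E' : Type v} [AddCommGroup E'] [Module K E'],
    ∀ (t' : SuperAlg K E') (ρ' : L → L → E'), IsB0Pairing s M N t' ρ' →
    ∃ f : E →ₗ[K] E', IsSuperHom t t' f ∧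
      ∀ (i j : ZMod 2), ∀ m ∈ M ⊓ s.gr i, ∀ n ∈ N ⊓ s.gr j, f (ρ m n) = ρ' m n

/-- Generators of `M₀(M,N)` inside the exterior product. -/
def M0Set (s : SuperAlg K L) (M N : Submodule K L) (ρ : L → L → E) : Set E :=
  {e : E | ∃ i j i' j' : ZMod 2, ∃ m ∈ M ⊓ s.gr i, ∃ n ∈ N ⊓ s.gr j,
      ∃ m' ∈ M ⊓ s.gr i', ∃ n' ∈ N ⊓ s.gr j',
      s.bk m n + sgn i' j' • s.bk m' n' = 0 ∧ e = ρ m n + sgn i' j' • ρ m' n'} ∪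
  {e : E | ∃ m ∈ M ⊓ s.gr 0, ∃ n ∈ N ⊓ s.gr 0, s.bk m n = 0 ∧ e = ρ m n}

/-- `M₀(M,N)`, the graded submodule of the exterior product generated
by the commutativity-preserving relations. -/
def M0 (s : SuperAlg K L) (M N : Submodule K L) (ρ : L → L → E) : Submodule K E :=
  Submodule.span K (M0Set s M N ρ)

/-- `κ` is the commutator map `κ̃ : m ∧ n ↦ [m,n]`. -/
def IsCommMap (s : SuperAlg K L) (M N : Submodule K L) (ρ : L → L → E)
    (κ : E →ₗ[K] L) : Prop :=
  ∀ (i j : ZMod 2), ∀ m ∈ M ⊓ s.gr i, ∀ n ∈ N ⊓ s.gr j, κ (ρ m n) = s.bk m n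

/-- The Bogomolov multiplier `B̃₀(L) = M(L)/M₀(L)` of `(L,s)` is trivial:
for any realization of the exterior product `L ∧ L` and of the commutator
map `κ̃`, the kernel `M(L)` of `κ̃` is contained in `M₀(L)`. -/
def HasTrivialBog (s : SuperAlg K L) : Prop :=
  ∀ {E' : Type v} [AddCommGroup E'] [Module K E'],
    ∀ (t : SuperAlg K E') (w : L → L → E'), IsExtProduct s ⊤ ⊤ t w →
    ∀ κ : E' →ₗ[K] L, IsCommMap s ⊤ ⊤ w κ → LinearMap.ker κ ≤ M0 s ⊤ ⊤ w

end Defs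

section Free

variable {F : Type v} [AddCommGroup F] [Module K F]

/-- `(F, sF)` is the free Lie superalgebra on the `ℤ₂`-graded set `X`. -/
structure IsFreeSuper (sF : SuperAlg K F) (X : ZMod 2 → Set F) : Prop where
  subset : ∀ i : ZMod 2, X i ⊆ sF.gr i
  gen : lieSpan sF (X 0 ∪ X 1) = ⊤
  lift : ∀ {M : Type v} [AddCommGroup M] [Module K M],
    ∀ (sM : SuperAlg K M) (f : F → M), (∀ i : ZMod 2, ∀ x ∈ X i, f x ∈ sM.gr i) →
    ∃ g : F →ₗ[K] M, IsSuperHom sF sM g ∧ ∀ x ∈ X 0 ∪ X 1, g x = f x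

end Free

end BogomolovSuper

namespace BogomolovSuper

section Cyclic

variable {K : Type u} [CommRing K] {L E : Type v} [AddCommGroup L] [Module K L]
  [AddCommGroup E] [Module K E]

/-- All homogeneous brackets of total degree `k` are multiples of a single one. -/
def HasCyclicBrackets (s : SuperAlg K L) (k : ZMod 2) : Prop :=
  ∃ i j : ZMod 2, i + j = k ∧ ∃ u ∈ s.gr i, ∃ v ∈ s.gr j,
    ∀ i' j' : ZMod 2, i' + j' = k → ∀ x ∈ s.gr i', ∀ y ∈ s.gr j',
      ∃ c : K, s.bk x y = c • s.bk u v

theorem sgn_eq_one_or (i j : ZMod 2) : sgn i j = 1 ∨ sgn i j = -1 :=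
  neg_one_pow_eq_or ℤ _

theorem zmod_two_cases : ∀ i : ZMod 2, i = 0 ∨ i = 1 := by decide

theorem sub_smul_mem_M0 {s : SuperAlg K L} {t : SuperAlg K E} {w : L → L → E}
    (hw : IsExtPairing s ⊤ ⊤ t w) {i j i' j' : ZMod 2} {x y u v : L}
    (hx : x ∈ s.gr i) (hy : y ∈ s.gr j) (hu : u ∈ s.gr i') (hv : v ∈ s.gr j') (c : K)
    (h : s.bk x y = c • s.bk u v) : w x y - c • w u v ∈ M0 s ⊤ ⊤ w := by
  have hsm (d : K) : w (d • u) v = d • w u v :=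
    hw.smul_left d i' j' u ⟨trivial, hu⟩ v ⟨trivial, hv⟩
  refine Submodule.subset_span (Or.inl ?_)
  rcases sgn_eq_one_or i' j' with hs | hs
  · refine ⟨i, j, i', j', x, ⟨trivial, hx⟩, y, ⟨trivial, hy⟩, (-c) • u,
      ⟨trivial, Submodule.smul_mem _ _ hu⟩, v, ⟨trivial, hv⟩, ?_, ?_⟩
    · simp [hs, h]
    · rw [hsm, hs, one_smul, neg_smul, sub_eq_add_neg]
  · refine ⟨i, j, i', j', x, ⟨trivial, hx⟩, y, ⟨trivial, hy⟩, c • u,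
      ⟨trivial, Submodule.smul_mem _ _ hu⟩, v, ⟨trivial, hv⟩, ?_, ?_⟩
    · simp [hs, h]
    · rw [hsm, hs, neg_smul, one_smul, sub_eq_add_neg]

theorem mem_M0_of_bk_eq_zero {s : SuperAlg K L} {t : SuperAlg K E} {w : L → L → E}
    (hw : IsExtPairing s ⊤ ⊤ t w) {i j : ZMod 2} {x y : L}
    (hx : x ∈ s.gr i) (hy : y ∈ s.gr j) (h : s.bk x y = 0) : w x y ∈ M0 s ⊤ ⊤ w := by
  simpa using sub_smul_mem_M0 hw hx hy hx hy 0 (by simpa using h)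

theorem M0_le_ker {s : SuperAlg K L} {w : L → L → E} {κ : E →ₗ[K] L}
    (hκ : IsCommMap s ⊤ ⊤ w κ) : M0 s ⊤ ⊤ w ≤ LinearMap.ker κ := by
  refine Submodule.span_le.2 ?_
  rintro e (⟨i, j, i', j', m, hm, n, hn, m', hm', n', hn', h, rfl⟩ | ⟨m, hm, n, hn, h, rfl⟩)
  · simpa [hκ i j m hm n hn, hκ i' j' m' hm' n' hn'] using h
  · simpa [hκ 0 0 m hm n hn] using h

theorem hasTrivialBog_of_cyclic (s : SuperAlg K L) (h₀ : HasCyclicBrackets s 0)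
    (h₁ : HasCyclicBrackets s 1) : HasTrivialBog s := by
  intro E _ _ t w hw κ hκ e he
  obtain ⟨i₀, j₀, hij₀, u₀, hu₀, v₀, hv₀, hc₀⟩ := h₀
  obtain ⟨i₁, j₁, hij₁, u₁, hu₁, v₁, hv₁, hc₁⟩ := h₁
  have key : ∀ e : E, ∃ c d : K, e - (c • w u₀ v₀ + d • w u₁ v₁) ∈ M0 s ⊤ ⊤ w := by
    intro e
    have hmem : e ∈ Submodule.span K (wedgeSet s ⊤ ⊤ w) := hw.gen ▸ Submodule.mem_top
    induction hmem using Submodule.span_induction with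
    | mem e h =>
      obtain ⟨i, j, m, hm, n, hn, rfl⟩ := h
      rcases zmod_two_cases (i + j) with hk | hk
      · obtain ⟨c, hc⟩ := hc₀ i j hk m hm.2 n hn.2
        exact ⟨c, 0, by simpa using sub_smul_mem_M0 hw.pairing hm.2 hn.2 hu₀ hv₀ c hc⟩
      · obtain ⟨d, hd⟩ := hc₁ i j hk m hm.2 n hn.2
        exact ⟨0, d, by simpa using sub_smul_mem_M0 hw.pairing hm.2 hn.2 hu₁ hv₁ d hd⟩
    | zero => exact ⟨0, 0, by simp⟩
    | add e e' _ _ h h' =>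
      obtain ⟨c, d, h⟩ := h
      obtain ⟨c', d', h'⟩ := h'
      refine ⟨c + c', d + d', ?_⟩
      convert add_mem h h' using 1
      module
    | smul r e _ h =>
      obtain ⟨c, d, h⟩ := h
      refine ⟨r * c, r * d, ?_⟩
      convert Submodule.smul_mem _ r h using 1
      module
  obtain ⟨c, d, hcd⟩ := key e
  have hsum : c • s.bk u₀ v₀ + d • s.bk u₁ v₁ = 0 := by
    have := M0_le_ker hκ hcd
    rw [LinearMap.mem_ker] at this he
    simpa [he, hκ i₀ j₀ u₀ ⟨trivial, hu₀⟩ v₀ ⟨trivial, hv₀⟩,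
      hκ i₁ j₁ u₁ ⟨trivial, hu₁⟩ v₁ ⟨trivial, hv₁⟩, ← neg_add_rev, add_comm] using this
  have hm₀ : c • s.bk u₀ v₀ ∈ s.gr 0 :=
    Submodule.smul_mem _ _ (hij₀ ▸ s.bk_gr i₀ j₀ u₀ hu₀ v₀ hv₀)
  have hm₁ : d • s.bk u₁ v₁ ∈ s.gr 1 :=
    Submodule.smul_mem _ _ (hij₁ ▸ s.bk_gr i₁ j₁ u₁ hu₁ v₁ hv₁)
  have hz₀ : c • s.bk u₀ v₀ = 0 := by
    have : c • s.bk u₀ v₀ ∈ s.gr 0 ⊓ s.gr 1 :=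
      ⟨hm₀, by rw [eq_neg_of_add_eq_zero_left hsum]; exact neg_mem hm₁⟩
    simpa [s.gr_inf] using this
  have hz₁ : d • s.bk u₁ v₁ = 0 := by simpa [hz₀] using hsum
  have hw₀ : c • w u₀ v₀ ∈ M0 s ⊤ ⊤ w := by
    rw [← hw.pairing.smul_left c i₀ j₀ u₀ ⟨trivial, hu₀⟩ v₀ ⟨trivial, hv₀⟩]
    exact mem_M0_of_bk_eq_zero hw.pairing (Submodule.smul_mem _ c hu₀) hv₀ (by simpa using hz₀)
  have hw₁ : d • w u₁ v₁ ∈ M0 s ⊤ ⊤ w := by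
    rw [← hw.pairing.smul_left d i₁ j₁ u₁ ⟨trivial, hu₁⟩ v₁ ⟨trivial, hv₁⟩]
    exact mem_M0_of_bk_eq_zero hw.pairing (Submodule.smul_mem _ d hu₁) hv₁ (by simpa using hz₁)
  simpa using add_mem hcd (add_mem hw₀ hw₁)

end Cyclic

section Field

variable {K : Type u} [Field K] {L : Type v} [AddCommGroup L] [Module K L]

theorem hasCyclicBrackets_of_finrank_eq_one (s : SuperAlg K L) (k : ZMod 2)
    (h : Module.finrank K (s.gr k) = 1) : HasCyclicBrackets s k := by
  by_cases hne : ∃ i j : ZMod 2, i + j = k ∧ ∃ u ∈ s.gr i, ∃ v ∈ s.gr j, s.bk u v ≠ 0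
  · obtain ⟨i, j, hij, u, hu, v, hv, huv⟩ := hne
    refine ⟨i, j, hij, u, hu, v, hv, fun i' j' hij' x hx y hy => ?_⟩
    obtain ⟨c, hc⟩ := exists_smul_eq_of_finrank_eq_one h
      (x := ⟨s.bk u v, hij ▸ s.bk_gr i j u hu v hv⟩) (by simpa using huv)
      ⟨s.bk x y, hij' ▸ s.bk_gr i' j' x hx y hy⟩
    exact ⟨c, (congrArg Subtype.val hc).symm⟩
  · push Not at hne
    exact ⟨k, 0, add_zero k, 0, zero_mem _, 0, zero_mem _, fun i' j' hij' x hx y hy =>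
      ⟨0, by simp [hne i' j' hij' x hx y hy]⟩⟩

theorem exists_decomp_of_finrank_eq_two {p : Submodule K L} (h : Module.finrank K p = 2)
    {b : L} (hb : b ∈ p) (hb0 : b ≠ 0) :
    ∃ c ∈ p, ∀ x ∈ p, ∃ r t : K, x = r • b + t • c := by
  have hbp : (⟨b, hb⟩ : p) ≠ 0 := by simpa using hb0
  have : FiniteDimensional K p := Module.finite_of_finrank_pos (by omega)
  obtain ⟨c, hc⟩ := exists_linearIndependent_pair_of_one_lt_finrank
    (by omega : 1 < Module.finrank K p) hbp
  have hspan := hc.span_eq_top_of_card_eq_finrank (by simp [h])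
  refine ⟨c, c.2, fun x hx => ?_⟩
  have hmem : (⟨x, hx⟩ : p) ∈ Submodule.span K (Set.range ![(⟨b, hb⟩ : p), c]) :=
    hspan ▸ Submodule.mem_top
  rw [Matrix.range_cons, Matrix.range_cons, Matrix.range_empty, Set.union_empty,
    Set.singleton_union, Submodule.mem_span_pair] at hmem
  obtain ⟨r, t, hrt⟩ := hmem
  exact ⟨r, t, (congrArg Subtype.val hrt).symm⟩

theorem hasCyclicBrackets_zero_of_finrank_odd_eq_one (s : SuperAlg K L)
    (h0 : Module.finrank K (s.gr 0) = 2) (h1 : Module.finrank K (s.gr 1) = 1)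
    {u : L} (hu : u ∈ s.gr 1) (huu : s.bk u u ≠ 0) :
    HasCyclicBrackets s 0 := by
  have hb : s.bk u u ∈ s.gr 0 := s.bk_gr 1 1 u hu u hu
  have hu0 : u ≠ 0 := by rintro rfl; simp at huu
  have hline (x : L) (hx : x ∈ s.gr 1) : ∃ c : K, c • u = x := by
    obtain ⟨c, hc⟩ := exists_smul_eq_of_finrank_eq_one h1
      (x := ⟨u, hu⟩) (by simpa using hu0) ⟨x, hx⟩
    exact ⟨c, congrArg Subtype.val hc⟩
  obtain ⟨c, hc, hdec⟩ := exists_decomp_of_finrank_eq_two h0 hb huu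
  obtain ⟨k, hk⟩ := hline (s.bk c u) (s.bk_gr 0 1 c hc u hu)
  have hcb : s.bk c (s.bk u u) = (2 * k) • s.bk u u := by
    have := s.jacobi 0 1 c hc u hu u
    simp only [← hk, sgn, ZMod.val_zero, zero_mul, pow_zero, one_smul, map_smul,
      LinearMap.smul_apply] at this
    rw [this]
    module
  have hbc : s.bk (s.bk u u) c = -((2 * k) • s.bk u u) := by
    simpa [sgn, hcb] using s.skew 0 0 (s.bk u u) hb c hc
  refine ⟨1, 1, rfl, u, hu, u, hu, fun i j hij x hx y hy => ?_⟩
  rcases zmod_two_cases i with rfl | rfl <;> rcases zmod_two_cases j with rfl | rfl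
  · obtain ⟨r, t, rfl⟩ := hdec x hx
    obtain ⟨r', t', rfl⟩ := hdec y hy
    refine ⟨t * r' * (2 * k) - r * t' * (2 * k), ?_⟩
    simp only [map_add, map_smul, LinearMap.add_apply, LinearMap.smul_apply,
      s.even_sq _ hb, s.even_sq _ hc, hcb, hbc]
    module
  · exact absurd hij (by decide)
  · exact absurd hij (by decide)
  · obtain ⟨a, rfl⟩ := hline x hx
    obtain ⟨a', rfl⟩ := hline y hy
    exact ⟨a' * a, by simp [mul_smul]⟩

variable [CharZero K] (s : SuperAlg K L)

theorem exists_odd_sq_ne_zero (h : ∃ u ∈ s.gr 1, ∃ v ∈ s.gr 1, s.bk u v ≠ 0) :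
    ∃ u ∈ s.gr 1, s.bk u u ≠ 0 := by
  obtain ⟨u, hu, v, hv, huv⟩ := h
  by_contra! hsq
  have hsum := hsq (u + v) (add_mem hu hv)
  have hsk : s.bk u v = s.bk v u := by
    simpa [sgn, ZMod.val_one] using s.skew 1 1 u hu v hv
  simp only [map_add, LinearMap.add_apply, hsq u hu, hsq v hv, ← hsk, zero_add, add_zero] at hsum
  exact huv (by simpa [← two_smul K] using hsum)

theorem bk_bk_self_left {u : L} (hu : u ∈ s.gr 1) : s.bk (s.bk u u) u = 0 := by
  have hsk : s.bk (s.bk u u) u = -s.bk u (s.bk u u) := by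
    simpa [sgn] using s.skew 0 1 (s.bk u u) (s.bk_gr 1 1 u hu u hu) u hu
  have hj : s.bk u (s.bk u u) = s.bk (s.bk u u) u - s.bk u (s.bk u u) := by
    simpa [sgn, ZMod.val_one, sub_eq_add_neg] using s.jacobi 1 1 u hu u hu u
  have h3 : (3 : K) • s.bk (s.bk u u) u = 0 := by
    rw [← sub_eq_zero] at hj
    rw [eq_neg_iff_add_eq_zero] at hsk
    calc (3 : K) • s.bk (s.bk u u) u
        = (2 : K) • (s.bk (s.bk u u) u + s.bk u (s.bk u u))
          - (s.bk u (s.bk u u) - (s.bk (s.bk u u) u - s.bk u (s.bk u u))) := by module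
      _ = 0 := by rw [hsk, hj, smul_zero, sub_zero]
  simpa using h3

theorem hasCyclicBrackets_one_of_finrank_even_eq_one (h0 : Module.finrank K (s.gr 0) = 1)
    {u : L} (hu : u ∈ s.gr 1) (huu : s.bk u u ≠ 0) : HasCyclicBrackets s 1 := by
  have hb : s.bk u u ∈ s.gr 0 := s.bk_gr 1 1 u hu u hu
  have hline (x : L) (hx : x ∈ s.gr 0) : ∃ c : K, c • s.bk u u = x := by
    obtain ⟨c, hc⟩ := exists_smul_eq_of_finrank_eq_one h0
      (x := ⟨s.bk u u, hb⟩) (by simpa using huu) ⟨x, hx⟩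
    exact ⟨c, congrArg Subtype.val hc⟩
  have hub : s.bk u (s.bk u u) = 0 := by
    simpa [sgn, bk_bk_self_left s hu] using s.skew 1 0 u hu (s.bk u u) hb
  have hbv (v : L) (hv : v ∈ s.gr 1) : s.bk (s.bk u u) v = 0 := by
    obtain ⟨c, hc⟩ := hline (s.bk u v) (s.bk_gr 1 1 u hu v hv)
    have := s.jacobi 1 1 u hu u hu v
    simpa [← hc, hub] using this.symm
  have heo (x : L) (hx : x ∈ s.gr 0) (v : L) (hv : v ∈ s.gr 1) : s.bk x v = 0 := by
    obtain ⟨c, rfl⟩ := hline x hx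
    simp [hbv v hv]
  refine ⟨1, 0, rfl, 0, zero_mem _, 0, zero_mem _, fun i j hij x hx y hy => ⟨0, ?_⟩⟩
  rw [zero_smul]
  rcases zmod_two_cases i with rfl | rfl <;> rcases zmod_two_cases j with rfl | rfl
  · exact absurd hij (by decide)
  · exact heo x hx y hy
  · rw [s.skew 1 0 x hx y hy, heo y hy x hx, smul_zero, neg_zero]
  · exact absurd hij (by decide)

end Field

/-- Every nontrivial real Lie superalgebra `L` of dimension `3`
(i.e. `[L₁, L₁] ≠ 0`; by Backhouse's classification these are exactly the
algebras `L_{(2,1)}`, `L¹_{(1,2)}` and `L²_{(1,2)}` listed in the paper) has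
trivial Bogomolov multiplier `B̃₀(L) = 0`. -/
theorem nontrivial_real_dim_three_trivial_bogomolov
    {L : Type v} [AddCommGroup L] [Module ℝ L] [FiniteDimensional ℝ L]
    (s : SuperAlg ℝ L)
    (hdim : Module.finrank ℝ L = 3)
    (hnontriv : ∃ u ∈ s.gr 1, ∃ v ∈ s.gr 1, s.bk u v ≠ 0) :
    HasTrivialBog s := by
  obtain ⟨u, hu, huu⟩ := exists_odd_sq_ne_zero s hnontriv
  have hb : s.bk u u ∈ s.gr 0 := s.bk_gr 1 1 u hu u hu
  have hu0 : u ≠ 0 := by rintro rfl; simp at huu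
  have hsum : Module.finrank ℝ (s.gr 0) + Module.finrank ℝ (s.gr 1) = 3 := by
    rw [← Submodule.finrank_sup_add_finrank_inf_eq, s.gr_sup, s.gr_inf, finrank_top,
      finrank_bot, hdim]
  have hpos0 : Module.finrank ℝ (s.gr 0) ≠ 0 := fun h =>
    huu (by simpa [Submodule.finrank_eq_zero.1 h] using hb)
  have hpos1 : Module.finrank ℝ (s.gr 1) ≠ 0 := fun h =>
    hu0 (by simpa [Submodule.finrank_eq_zero.1 h] using hu)
  obtain ⟨h0, -⟩ | ⟨h0, h1⟩ : (Module.finrank ℝ (s.gr 0) = 1 ∧ Module.finrank ℝ (s.gr 1) = 2) ∨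
      (Module.finrank ℝ (s.gr 0) = 2 ∧ Module.finrank ℝ (s.gr 1) = 1) := by omega
  · intro E' _ _
    exact hasTrivialBog_of_cyclic s (hasCyclicBrackets_of_finrank_eq_one s 0 h0)
      (hasCyclicBrackets_one_of_finrank_even_eq_one s h0 hu huu)
  · intro E' _ _
    exact hasTrivialBog_of_cyclic s (hasCyclicBrackets_zero_of_finrank_odd_eq_one s h0 h1 hu huu)
      (hasCyclicBrackets_of_finrank_eq_one s 1 h1)

end BogomolovSuper
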